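/- arXiv:2510.09208 — 9 statements merged into one kernel-verified Lean document; each statement's English description precedes it below -/
import Mathlib

section
/- Let K be a field and (A,·,P,Q) an admissible averaging commutative algebra over K. Suppose r ∈ A⊗A is a solution of the AAYBE in (A,·,P,Q) and r+τ(r) is invariant on (A,·). Define Δ_r : A → A⊗A by Δ_r(x) = (id⊗L(x) − L(x)⊗id)(r). Then for all x,y ∈ A: τ(Δ_r(x)) = Δ_r(x); (Δ_r⊗id)(Δ_r(x)) = (id⊗Δ_r)(Δ_r(x)); Δ_r(x·y) = (L(x)⊗id)(Δ_r(y)) + (id⊗L(y))(Δ_r(x)); (Q⊗Q)(Δ_r(x)) = (Q⊗id)(Δ_r(Q(x))); and (Q⊗P)(Δ_r(x)) = (Q⊗id)(Δ_r(P(x))) = (id⊗P)(Δ_r(P(x))). That is, (A,·,Δ_r,P,Q) is an averaging commutative and cocommutative infinitesimal bialgebra. -/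
open TensorProduct

noncomputable section

namespace Paper

variable {K : Type*} [Field K]

section Defs

variable {A : Type*} [AddCommGroup A] [Module K A]
variable {V : Type*} [AddCommGroup V] [Module K V]

/-- Commutativity of a bilinear multiplication. -/
def IsComm (m : A →ₗ[K] A →ₗ[K] A) : Prop := ∀ x y, m x y = m y x

/-- Associativity of a bilinear multiplication. -/
def IsAssoc (m : A →ₗ[K] A →ₗ[K] A) : Prop := ∀ x y z, m (m x y) z = m x (m y z)

/-- `P` is an averaging operator on `(A, m)`. -/
def IsAveragingOp (m : A →ₗ[K] A →ₗ[K] A) (P : A →ₗ[K] A) : Prop :=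
  ∀ x y, m (P x) (P y) = P (m (P x) y) ∧ P (m (P x) y) = P (m x (P y))

/-- `(A, m, P, Q)` is an admissible averaging commutative algebra. -/
def IsAdmissibleAveraging (m : A →ₗ[K] A →ₗ[K] A) (P Q : A →ₗ[K] A) : Prop :=
  IsComm m ∧ IsAssoc m ∧ IsAveragingOp m P ∧
    ∀ x y, m (P x) (Q y) = Q (m (P x) y) ∧ Q (m (P x) y) = Q (m x (Q y))

/-- The flip `τ` on `A ⊗ A`. -/
def tau (r : A ⊗[K] A) : A ⊗[K] A := TensorProduct.comm K A A r

/-- The linear map `A* → A`, `a* ↦ r♯(a*)`, associated with `r ∈ A ⊗ A`,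
determined by `⟨r♯(a*), b*⟩ = ⟨r, a* ⊗ b*⟩`. -/
def sharp (r : A ⊗[K] A) : Module.Dual K A →ₗ[K] A :=
  (TensorProduct.lid K A).toLinearMap ∘ₗ LinearMap.applyₗ r ∘ₗ LinearMap.rTensorHom A

/-- `s ∈ A ⊗ A` is invariant on `(A, m)`:  `(id ⊗ L(x) - L(x) ⊗ id) s = 0` for all `x`. -/
def IsInvariant (m : A →ₗ[K] A →ₗ[K] A) (s : A ⊗[K] A) : Prop :=
  ∀ x : A, LinearMap.lTensor A (m x) s = LinearMap.rTensor A (m x) s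

/-- `(u⊗v)⊗(u'⊗v') ↦ b(u⊗u') ⊗ v ⊗ v'`. -/
def place1 (b : A ⊗[K] A →ₗ[K] A) :
    (A ⊗[K] A) ⊗[K] (A ⊗[K] A) →ₗ[K] A ⊗[K] (A ⊗[K] A) :=
  LinearMap.rTensor (A ⊗[K] A) b ∘ₗ (TensorProduct.tensorTensorTensorComm K A A A A).toLinearMap

/-- `(u⊗v)⊗(u'⊗v') ↦ u ⊗ b(v⊗u') ⊗ v'`. -/
def place2 (b : A ⊗[K] A →ₗ[K] A) :
    (A ⊗[K] A) ⊗[K] (A ⊗[K] A) →ₗ[K] A ⊗[K] (A ⊗[K] A) :=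
  LinearMap.lTensor A (LinearMap.rTensor A b) ∘ₗ
    LinearMap.lTensor A (TensorProduct.assoc K A A A).symm.toLinearMap ∘ₗ
      (TensorProduct.assoc K A A (A ⊗[K] A)).toLinearMap

/-- `(u⊗v)⊗(u'⊗v') ↦ u ⊗ u' ⊗ b(v⊗v')`. -/
def place3 (b : A ⊗[K] A →ₗ[K] A) :
    (A ⊗[K] A) ⊗[K] (A ⊗[K] A) →ₗ[K] A ⊗[K] (A ⊗[K] A) :=
  (TensorProduct.assoc K A A A).toLinearMap ∘ₗ LinearMap.lTensor (A ⊗[K] A) b ∘ₗ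
    (TensorProduct.tensorTensorTensorComm K A A A A).toLinearMap

/-- A bilinear multiplication as a linear map on the tensor square. -/
def liftM (m : A →ₗ[K] A →ₗ[K] A) : A ⊗[K] A →ₗ[K] A := TensorProduct.lift m

/-- The opposite multiplication as a linear map on the tensor square: `u ⊗ v ↦ m v u`. -/
def flipM (m : A →ₗ[K] A →ₗ[K] A) : A ⊗[K] A →ₗ[K] A :=
  TensorProduct.lift m ∘ₗ (TensorProduct.comm K A A).toLinearMap

/-- For `r = Σᵢ uᵢ ⊗ vᵢ`, the element
`𝐀(r) = Σᵢⱼ (uᵢ·uⱼ)⊗vᵢ⊗vⱼ − uᵢ⊗(uⱼ·vᵢ)⊗vⱼ + uᵢ⊗uⱼ⊗(vᵢ·vⱼ)` of `A⊗A⊗A`. -/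
def Acal (m : A →ₗ[K] A →ₗ[K] A) (r : A ⊗[K] A) : A ⊗[K] (A ⊗[K] A) :=
  place1 (liftM m) (r ⊗ₜ[K] r) - place2 (flipM m) (r ⊗ₜ[K] r) + place3 (liftM m) (r ⊗ₜ[K] r)

/-- `r` is a solution of the averaging associative Yang–Baxter equation (AAYBE) in
`(A, m, P, Q)`: `𝐀(r) = 0`, `(P⊗id − id⊗Q)(r) = 0` and `(Q⊗id − id⊗P)(r) = 0`. -/
def IsAAYBESolution (m : A →ₗ[K] A →ₗ[K] A) (P Q : A →ₗ[K] A) (r : A ⊗[K] A) : Prop :=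
  Acal m r = 0 ∧ LinearMap.rTensor A P r = LinearMap.lTensor A Q r ∧
    LinearMap.rTensor A Q r = LinearMap.lTensor A P r

/-- The co-multiplication `Δ_r : x ↦ (id ⊗ L(x) − L(x) ⊗ id)(r)`. -/
def DeltaMap (m : A →ₗ[K] A →ₗ[K] A) (r : A ⊗[K] A) : A →ₗ[K] A ⊗[K] A :=
  (LinearMap.applyₗ r ∘ₗ LinearMap.lTensorHom A) ∘ₗ m -
    (LinearMap.applyₗ r ∘ₗ LinearMap.rTensorHom A) ∘ₗ m

/-- The dual representation map `x ↦ (ρ(x))*`. -/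
def dualRep (ρ : A →ₗ[K] V →ₗ[K] V) : A →ₗ[K] Module.Dual K V →ₗ[K] Module.Dual K V :=
  Module.Dual.transpose ∘ₗ ρ

/-- `(ρ, α, β, V)` is a representation of the admissible averaging commutative algebra
`(A, m, P, Q)`. -/
def IsRep (m : A →ₗ[K] A →ₗ[K] A) (P Q : A →ₗ[K] A)
    (ρ : A →ₗ[K] V →ₗ[K] V) (α β : V →ₗ[K] V) : Prop :=
  (∀ x y v, ρ (m x y) v = ρ x (ρ y v)) ∧
  (∀ x v, ρ (P x) (α v) = α (ρ (P x) v) ∧ α (ρ (P x) v) = α (ρ x (α v))) ∧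
  (∀ x v, ρ (P x) (β v) = β (ρ (P x) v) ∧ β (ρ (P x) v) = β (ρ x (β v))) ∧
  (∀ x v, ρ (Q x) (α v) = β (ρ x (α v)) ∧ β (ρ x (α v)) = β (ρ (Q x) v))

/-- `(ρ, α, β, V, mV)` is an `(A, m, P, Q)`-representation algebra. -/
def IsRepAlg (m : A →ₗ[K] A →ₗ[K] A) (P Q : A →ₗ[K] A)
    (ρ : A →ₗ[K] V →ₗ[K] V) (α β : V →ₗ[K] V) (mV : V →ₗ[K] V →ₗ[K] V) : Prop :=
  IsRep m P Q ρ α β ∧ IsAdmissibleAveraging mV α β ∧ ∀ x u v, ρ x (mV u v) = mV (ρ x u) v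

/-- The semidirect-product multiplication on `A × V`:
`(x+u)·(y+v) = x·y + ρ(x)v + ρ(y)u + u ·_V v`. -/
def sdMul (m : A →ₗ[K] A →ₗ[K] A) (ρ : A →ₗ[K] V →ₗ[K] V) (mV : V →ₗ[K] V →ₗ[K] V) :
    (A × V) →ₗ[K] (A × V) →ₗ[K] (A × V) :=
  LinearMap.mk₂ K
    (fun p q => (m p.1 q.1, ρ p.1 q.2 + ρ q.1 p.2 + mV p.2 q.2))
    (fun p p' q => by
      simp only [Prod.fst_add, Prod.snd_add, map_add, LinearMap.add_apply, Prod.mk_add_mk,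
        Prod.mk.injEq]
      exact ⟨trivial, by abel⟩)
    (fun c p q => by
      simp only [Prod.smul_fst, Prod.smul_snd, map_smul, LinearMap.smul_apply, Prod.smul_mk,
        smul_add, Prod.mk.injEq])
    (fun p q q' => by
      simp only [Prod.fst_add, Prod.snd_add, map_add, LinearMap.add_apply, Prod.mk_add_mk,
        Prod.mk.injEq]
      exact ⟨trivial, by abel⟩)
    (fun c p q => by
      simp only [Prod.smul_fst, Prod.smul_snd, map_smul, LinearMap.smul_apply, Prod.smul_mk,
        smul_add, Prod.mk.injEq])

/-- Nondegeneracy of a bilinear form. -/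
def IsNondeg (B : A →ₗ[K] A →ₗ[K] K) : Prop := ∀ x, (∀ y, B x y = 0) → x = 0

/-- `(A, m, B)` is a symmetric Frobenius commutative algebra. -/
def IsSymFrob (m : A →ₗ[K] A →ₗ[K] A) (B : A →ₗ[K] A →ₗ[K] K) : Prop :=
  IsComm m ∧ IsAssoc m ∧ (∀ x y, B x y = B y x) ∧ IsNondeg B ∧
    ∀ x y z, B (m x y) z = B x (m y z)

/-- `R` is a Rota–Baxter operator of weight `l` on `(A, m)`. -/
def IsRB (m : A →ₗ[K] A →ₗ[K] A) (R : A →ₗ[K] A) (l : K) : Prop :=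
  ∀ x y, m (R x) (R y) = R (m (R x) y + m x (R y) + l • m x y)

/-- `(A, m, R, B)` is a symmetric Rota–Baxter Frobenius commutative algebra of weight `l`. -/
def IsSymRBFrob (m : A →ₗ[K] A →ₗ[K] A) (R : A →ₗ[K] A) (B : A →ₗ[K] A →ₗ[K] K) (l : K) :
    Prop :=
  IsSymFrob m B ∧ IsRB m R l ∧ ∀ x y, B (R x) y + B x (R y) + l • B x y = 0

/-- `(A, m, P, R, B)` is a symmetric averaging Rota–Baxter Frobenius commutative algebra of
weight `l`. -/
def IsSymAvgRBFrob (m : A →ₗ[K] A →ₗ[K] A) (P R : A →ₗ[K] A) (B : A →ₗ[K] A →ₗ[K] K)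
    (l : K) : Prop :=
  IsSymRBFrob m R B l ∧ IsAveragingOp m P ∧ P ∘ₗ R = R ∘ₗ P

/-- `(A, tr, lt)` is a special apre-perm algebra (with `x ▷ y = tr x y`, `x ◁ y = lt x y`). -/
def IsSAPP (tr lt : A →ₗ[K] A →ₗ[K] A) : Prop :=
  (∀ x y, lt x y = lt y x) ∧
  (∀ x y z, (tr + lt) x ((tr + lt) y z) = (tr + lt) ((tr + lt) x y) z ∧
      (tr + lt) ((tr + lt) x y) z = (tr + lt) ((tr + lt) y x) z) ∧
  (∀ x y z, lt ((tr + lt) x y) z = (tr + lt) x (lt y z) ∧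
      (tr + lt) x (lt y z) = - lt x (lt y z))

/-- `f(x) = id ⊗ R∘(x) + L◁(x) ⊗ id` on `A ⊗ A`. -/
def fmap (tr lt : A →ₗ[K] A →ₗ[K] A) (x : A) : A ⊗[K] A →ₗ[K] A ⊗[K] A :=
  LinearMap.lTensor A ((tr + lt).flip x) + LinearMap.rTensor A (lt x)

/-- `g(x) = L∘(x) ⊗ id − id ⊗ L∘(x)` on `A ⊗ A`. -/
def gmap (tr lt : A →ₗ[K] A →ₗ[K] A) (x : A) : A ⊗[K] A →ₗ[K] A ⊗[K] A :=
  LinearMap.rTensor A ((tr + lt) x) - LinearMap.lTensor A ((tr + lt) x)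

/-- For `r = Σᵢ uᵢ ⊗ vᵢ`, the element
`SA(r) = Σᵢⱼ (uᵢ∘uⱼ)⊗vᵢ⊗vⱼ + uᵢ⊗(vᵢ◁uⱼ)⊗vⱼ + uᵢ⊗uⱼ⊗(vⱼ∘vᵢ)` of `A⊗A⊗A`. -/
def SAcal (tr lt : A →ₗ[K] A →ₗ[K] A) (r : A ⊗[K] A) : A ⊗[K] (A ⊗[K] A) :=
  place1 (liftM (tr + lt)) (r ⊗ₜ[K] r) + place2 (liftM lt) (r ⊗ₜ[K] r) +
    place3 (flipM (tr + lt)) (r ⊗ₜ[K] r)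

/-- `(A, tr, lt, B)` is a quadratic special apre-perm algebra. -/
def IsQuadSAPP (tr lt : A →ₗ[K] A →ₗ[K] A) (B : A →ₗ[K] A →ₗ[K] K) : Prop :=
  IsSAPP tr lt ∧ (∀ x y, B x y = B y x) ∧ IsNondeg B ∧
    ∀ x y z, B (lt x y) z = - B x ((tr + lt) z y)

/-- `(A, tr, lt, R, B)` is a quadratic Rota–Baxter special apre-perm algebra of weight `l`. -/
def IsQuadRBSAPP (tr lt : A →ₗ[K] A →ₗ[K] A) (R : A →ₗ[K] A) (B : A →ₗ[K] A →ₗ[K] K)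
    (l : K) : Prop :=
  IsQuadSAPP tr lt B ∧ IsRB tr R l ∧ IsRB lt R l ∧
    ∀ x y, B (R x) y + B x (R y) + l • B x y = 0

/-- `x ◁ y = −Q(x·y)` as a bilinear map. -/
def ltOf (m : A →ₗ[K] A →ₗ[K] A) (Q : A →ₗ[K] A) : A →ₗ[K] A →ₗ[K] A :=
  - (LinearMap.llcomp K A A A Q ∘ₗ m)

/-- `x ▷ y = P(x)·y + Q(x·y)` as a bilinear map. -/
def trOf (m : A →ₗ[K] A →ₗ[K] A) (P Q : A →ₗ[K] A) : A →ₗ[K] A →ₗ[K] A :=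
  m ∘ₗ P + LinearMap.llcomp K A A A Q ∘ₗ m

/-- The multiplication `a* ◇_s b* = L*(s♯(a*))(b*)` on `A*`. -/
def diamondMap (m : A →ₗ[K] A →ₗ[K] A) (s : A ⊗[K] A) :
    Module.Dual K A →ₗ[K] Module.Dual K A →ₗ[K] Module.Dual K A :=
  dualRep m ∘ₗ sharp s

/-- The natural bilinear form `B_d(x+a*, y+b*) = ⟨a*, y⟩ + ⟨b*, x⟩` on `A × A*`. -/
def pairForm : (A × Module.Dual K A) →ₗ[K] (A × Module.Dual K A) →ₗ[K] K :=
  LinearMap.mk₂ K (fun p q => p.2 q.1 + q.2 p.1)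
    (fun p p' q => by
      simp only [Prod.fst_add, Prod.snd_add, LinearMap.add_apply, map_add]
      ring)
    (fun c p q => by
      simp only [Prod.smul_fst, Prod.smul_snd, LinearMap.smul_apply, map_smul, smul_eq_mul]
      ring)
    (fun p q q' => by
      simp only [Prod.fst_add, Prod.snd_add, LinearMap.add_apply, map_add]
      ring)
    (fun c p q => by
      simp only [Prod.smul_fst, Prod.smul_snd, LinearMap.smul_apply, map_smul, smul_eq_mul]
      ring)

/-- The Zinbiel and admissibility axioms for `(A, ⋆, P, Q)`. -/
def IsAdmAvgZinbiel (st : A →ₗ[K] A →ₗ[K] A) (P Q : A →ₗ[K] A) : Prop :=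
  (∀ x y z, st x (st y z) = st (st x y) z + st (st y x) z) ∧
  (∀ x y, st (P x) (P y) = P (st (P x) y) ∧ P (st (P x) y) = P (st x (P y))) ∧
  (∀ x y, Q (st (P x) y) = st (P x) (Q y) ∧ st (P x) (Q y) = Q (st x (Q y))) ∧
  (∀ x y, Q (st (Q x) y) = st (Q x) (P y) ∧ st (Q x) (P y) = Q (st x (P y)))

end Defs

end Paper

section Theorems

open Paper

variable {K : Type*} [Field K]
variable {A : Type*} [AddCommGroup A] [Module K A]
variable {V : Type*} [AddCommGroup V] [Module K V]

theorem helper_delta_apply (m : A →ₗ[K] A →ₗ[K] A) (r : A ⊗[K] A) (x : A) :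
    DeltaMap m r x = LinearMap.lTensor A (m x) r - LinearMap.rTensor A (m x) r := rfl

theorem helper_delta_add (m : A →ₗ[K] A →ₗ[K] A) (r s : A ⊗[K] A) :
    DeltaMap m (r + s) = DeltaMap m r + DeltaMap m s := by
  ext x
  simp only [helper_delta_apply, map_add, LinearMap.add_apply]
  abel

theorem helper_delta_zero (m : A →ₗ[K] A →ₗ[K] A) :
    DeltaMap m (0 : A ⊗[K] A) = 0 := by
  ext x
  simp [helper_delta_apply]

theorem helper_right (m : A →ₗ[K] A →ₗ[K] A) (hc : IsComm m) (ha : IsAssoc m) (x : A)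
    (r s : A ⊗[K] A) :
    LinearMap.lTensor A (DeltaMap m s) (DeltaMap m r x) =
      LinearMap.lTensor A (LinearMap.lTensor A (m x)) (place3 (liftM m) (r ⊗ₜ[K] s))
      - LinearMap.lTensor A (LinearMap.rTensor A (m x)) (place2 (flipM m) (r ⊗ₜ[K] s))
      - LinearMap.rTensor (A ⊗[K] A) (m x) (place3 (liftM m) (r ⊗ₜ[K] s))
      + LinearMap.rTensor (A ⊗[K] A) (m x) (place2 (flipM m) (r ⊗ₜ[K] s)) := by
  induction s using TensorProduct.induction_on with
  | zero => simp [helper_delta_zero]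
  | add s t hs ht =>
    simp only [helper_delta_add, LinearMap.lTensor_add, LinearMap.add_apply, hs, ht,
      TensorProduct.tmul_add, map_add]
    abel
  | tmul a b =>
    induction r using TensorProduct.induction_on with
    | zero => simp [helper_delta_zero]
    | add s t hs ht =>
      simp only [helper_delta_add, LinearMap.add_apply, hs, ht,
        TensorProduct.add_tmul, map_add]
      abel
    | tmul c d =>
      simp only [helper_delta_apply, place2, place3, Paper.liftM, flipM, LinearMap.lTensor_tmul,
        LinearMap.rTensor_tmul, map_sub, LinearMap.comp_apply, LinearEquiv.coe_coe,
        TensorProduct.assoc_tmul, TensorProduct.assoc_symm_tmul, TensorProduct.comm_tmul,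
        TensorProduct.tensorTensorTensorComm_tmul, TensorProduct.lift.tmul,
        TensorProduct.tmul_sub, ha x d b, ha x d a, hc a d]
      abel

theorem helper_left (m : A →ₗ[K] A →ₗ[K] A) (hc : IsComm m) (ha : IsAssoc m) (x : A)
    (r s : A ⊗[K] A) :
    TensorProduct.assoc K A A A (LinearMap.rTensor A (DeltaMap m s) (DeltaMap m r x)) =
      LinearMap.lTensor A (LinearMap.lTensor A (m x)) (place2 (flipM m) (s ⊗ₜ[K] r))
      - LinearMap.lTensor A (LinearMap.lTensor A (m x)) (place1 (liftM m) (s ⊗ₜ[K] r))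
      - LinearMap.lTensor A (LinearMap.rTensor A (m x)) (place2 (flipM m) (s ⊗ₜ[K] r))
      + LinearMap.rTensor (A ⊗[K] A) (m x) (place1 (liftM m) (s ⊗ₜ[K] r)) := by
  induction s using TensorProduct.induction_on with
  | zero => simp [helper_delta_zero]
  | add s t hs ht =>
    simp only [helper_delta_add, LinearMap.rTensor_add, LinearMap.add_apply, hs, ht,
      TensorProduct.add_tmul, map_add]
    abel
  | tmul a b =>
    induction r using TensorProduct.induction_on with
    | zero => simp [helper_delta_zero]
    | add s t hs ht =>
      simp only [helper_delta_add, LinearMap.add_apply, hs, ht,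
        TensorProduct.tmul_add, map_add]
      abel
    | tmul c d =>
      simp only [helper_delta_apply, place1, place2, Paper.liftM, flipM, LinearMap.lTensor_tmul,
        LinearMap.rTensor_tmul, map_sub, LinearMap.comp_apply, LinearEquiv.coe_coe,
        TensorProduct.assoc_tmul, TensorProduct.assoc_symm_tmul, TensorProduct.comm_tmul,
        TensorProduct.tensorTensorTensorComm_tmul, TensorProduct.lift.tmul,
        TensorProduct.sub_tmul, ha x c b, ha x c a, hc a c]
      abel

theorem quasi_triangular_avg_bialgebra
    (m : A →ₗ[K] A →ₗ[K] A) (P Q : A →ₗ[K] A)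
    (hadm : IsAdmissibleAveraging m P Q)
    (r : A ⊗[K] A)
    (hsol : IsAAYBESolution m P Q r)
    (hinv : IsInvariant m (r + tau r)) :
    (∀ x : A, TensorProduct.comm K A A (DeltaMap m r x) = DeltaMap m r x) ∧
    (∀ x : A, TensorProduct.assoc K A A A
        (LinearMap.rTensor A (DeltaMap m r) (DeltaMap m r x)) =
      LinearMap.lTensor A (DeltaMap m r) (DeltaMap m r x)) ∧
    (∀ x y : A, DeltaMap m r (m x y) =
      LinearMap.rTensor A (m x) (DeltaMap m r y) +
        LinearMap.lTensor A (m y) (DeltaMap m r x)) ∧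
    (∀ x : A, TensorProduct.map Q Q (DeltaMap m r x) =
      LinearMap.rTensor A Q (DeltaMap m r (Q x))) ∧
    (∀ x : A, TensorProduct.map Q P (DeltaMap m r x) =
        LinearMap.rTensor A Q (DeltaMap m r (P x)) ∧
      LinearMap.rTensor A Q (DeltaMap m r (P x)) =
        LinearMap.lTensor A P (DeltaMap m r (P x))) := by
  obtain ⟨hc, ha, hP, hQ⟩ := hadm
  obtain ⟨hA, h1, h2⟩ := hsol
  -- elementary operator identities
  have eQP : ∀ x, Q ∘ₗ m x ∘ₗ P = m (Q x) ∘ₗ P := fun x => by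
    ext v
    simp only [LinearMap.comp_apply]
    rw [hc x, ← (hQ v x).1, hc]
  have eQP2 : ∀ x, Q ∘ₗ m x ∘ₗ P = Q ∘ₗ m (Q x) := fun x => by
    ext v
    simp only [LinearMap.comp_apply]
    rw [hc x, (hQ v x).2, hc]
  have eQQ : ∀ x, Q ∘ₗ m (P x) = Q ∘ₗ m x ∘ₗ Q := fun x => by
    ext v
    exact (hQ x v).2
  have eQ' : ∀ x, Q ∘ₗ m (P x) = m (P x) ∘ₗ Q := fun x => by
    ext v
    exact (hQ x v).1.symm
  have ePP : ∀ x, P ∘ₗ m x ∘ₗ P = m (P x) ∘ₗ P := fun x => by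
    ext v
    exact ((hP x v).1.trans (hP x v).2).symm
  have eP' : ∀ x, P ∘ₗ m (P x) = m (P x) ∘ₗ P := fun x => by
    ext v
    exact (hP x v).1.symm
  -- `Q` on the left factor becomes `P` on the right factor, and so on
  have mvQl : ∀ f g : A →ₗ[K] A, TensorProduct.map (f ∘ₗ Q) g r =
      TensorProduct.map f (g ∘ₗ P) r := fun f g => by
    have := congrArg (TensorProduct.map f g) h2
    simpa only [LinearMap.rTensor, LinearMap.lTensor, ← LinearMap.comp_apply,
      ← TensorProduct.map_comp, LinearMap.comp_id] using this
  have mvQr : ∀ f g : A →ₗ[K] A, TensorProduct.map (f ∘ₗ P) g r =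
      TensorProduct.map f (g ∘ₗ Q) r := fun f g => by
    have := congrArg (TensorProduct.map f g) h1
    simpa only [LinearMap.rTensor, LinearMap.lTensor, ← LinearMap.comp_apply,
      ← TensorProduct.map_comp, LinearMap.comp_id] using this
  have key : ∀ (f g : A →ₗ[K] A) (x : A), TensorProduct.map f g (DeltaMap m r x) =
      TensorProduct.map f (g ∘ₗ m x) r - TensorProduct.map (f ∘ₗ m x) g r := fun f g x => by
    simp only [helper_delta_apply, map_sub, LinearMap.rTensor, LinearMap.lTensor,
      ← LinearMap.comp_apply, ← TensorProduct.map_comp, LinearMap.comp_id]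
  have q1 : ∀ g : A →ₗ[K] A, TensorProduct.map Q g r = TensorProduct.map .id (g ∘ₗ P) r :=
    fun g => mvQl .id g
  have q2 : ∀ f : A →ₗ[K] A, TensorProduct.map f Q r = TensorProduct.map (f ∘ₗ P) .id r :=
    fun f => (mvQr f .id).symm
  have q3 : ∀ f : A →ₗ[K] A, TensorProduct.map f P r = TensorProduct.map (f ∘ₗ Q) .id r :=
    fun f => (mvQl f .id).symm
  refine ⟨?_, ?_, ?_, ?_, ?_⟩
  · intro x
    have h := hinv x
    have c1 : ∀ (f : A →ₗ[K] A) (t : A ⊗[K] A),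
        TensorProduct.comm K A A (LinearMap.lTensor A f t) =
        LinearMap.rTensor A f (TensorProduct.comm K A A t) := fun f t => by
      induction t using TensorProduct.induction_on with
      | zero => simp
      | tmul a b => simp
      | add a b h1 h2 => simp only [map_add, h1, h2]
    have c2 : ∀ (f : A →ₗ[K] A) (t : A ⊗[K] A),
        TensorProduct.comm K A A (LinearMap.rTensor A f t) =
        LinearMap.lTensor A f (TensorProduct.comm K A A t) := fun f t => by
      induction t using TensorProduct.induction_on with
      | zero => simp
      | tmul a b => simp
      | add a b h1 h2 => simp only [map_add, h1, h2]
    simp only [tau, map_add] at h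
    rw [helper_delta_apply, map_sub, c1, c2, sub_eq_sub_iff_add_eq_add, add_comm, ← h, add_comm]
  · intro x
    rw [helper_left m hc ha, helper_right m hc ha]
    have t1 := congrArg (LinearMap.lTensor A (LinearMap.lTensor A (m x))) hA
    have t2 := congrArg (LinearMap.rTensor (A ⊗[K] A) (m x)) hA
    simp only [Acal, map_add, map_sub, map_zero] at t1 t2
    have t3 := t2.trans t1.symm
    rw [← sub_eq_zero] at t3 ⊢
    rw [← t3]
    abel
  · intro x y
    have e1 : m (m x y) = m y ∘ₗ m x := by
      ext v
      rw [hc x y]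
      exact ha y x v
    have e2 : m (m x y) = m x ∘ₗ m y := by
      ext v
      exact ha x y v
    rw [LinearMap.rTensor, LinearMap.lTensor, key, key, helper_delta_apply,
      LinearMap.rTensor, LinearMap.lTensor, LinearMap.id_comp, LinearMap.id_comp, ← e1, ← e2]
    abel
  · intro x
    rw [LinearMap.rTensor, key, key, LinearMap.id_comp, q1, q1, q2]
    rw [LinearMap.comp_assoc, ← eQP2, eQP]
  · intro x
    rw [LinearMap.rTensor, LinearMap.lTensor, key, key, key, LinearMap.id_comp,
      q1, q1, q3, q3]
    rw [LinearMap.comp_assoc, LinearMap.comp_assoc, ePP, ← eQQ, eP', eQ']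
    exact ⟨rfl, rfl⟩

end Theorems
end
end

section
/- Let K be a field, (A,·,P,Q) an admissible averaging commutative algebra over K, and V a finite-dimensional K-vector space. If (μ,α,β,V) is a representation of (A,·,P,Q), then (μ*,β*,α*,V*) is also a representation of (A,·,P,Q), where ⟨μ*(x)(u*),v⟩ = ⟨u*,μ(x)(v)⟩ and α*,β* are the transposes of α,β. In particular, for finite-dimensional A, (L*, Q*, P*, A*) is a representation of (A,·,P,Q), where ⟨L*(x)(a*),y⟩ = ⟨a*, x·y⟩. -/
open TensorProduct

noncomputable section

section Theorems

open Paper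

variable {K : Type*} [Field K]
variable {A : Type*} [AddCommGroup A] [Module K A]
variable {V : Type*} [AddCommGroup V] [Module K V]

theorem isRep_dual_aux (m : A →ₗ[K] A →ₗ[K] A) (P Q : A →ₗ[K] A)
    (hcomm : IsComm m)
    (ρ : A →ₗ[K] V →ₗ[K] V) (α β : V →ₗ[K] V)
    (hrep : IsRep m P Q ρ α β) :
    IsRep m P Q (dualRep ρ) β.dualMap α.dualMap := by
  obtain ⟨h1, h2, h3, h4⟩ := hrep
  refine ⟨fun x y f => ?_, fun x f => ⟨?_, ?_⟩, fun x f => ⟨?_, ?_⟩, fun x f => ⟨?_, ?_⟩⟩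
  · refine LinearMap.ext fun v => ?_
    change f (ρ (m x y) v) = f (ρ y (ρ x v))
    rw [hcomm, h1]
  · refine LinearMap.ext fun v => ?_
    change f (β (ρ (P x) v)) = f (ρ (P x) (β v))
    rw [(h3 x v).1]
  · refine LinearMap.ext fun v => ?_
    change f (ρ (P x) (β v)) = f (β (ρ x (β v)))
    rw [(h3 x v).1, (h3 x v).2]
  · refine LinearMap.ext fun v => ?_
    change f (α (ρ (P x) v)) = f (ρ (P x) (α v))
    rw [(h2 x v).1]
  · refine LinearMap.ext fun v => ?_
    change f (ρ (P x) (α v)) = f (α (ρ x (α v)))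
    rw [(h2 x v).1, (h2 x v).2]
  · refine LinearMap.ext fun v => ?_
    change f (β (ρ (Q x) v)) = f (β (ρ x (α v)))
    rw [(h4 x v).2]
  · refine LinearMap.ext fun v => ?_
    change f (β (ρ x (α v))) = f (ρ (Q x) (α v))
    rw [(h4 x v).1]

theorem dual_representation [FiniteDimensional K A] [FiniteDimensional K V]
    (m : A →ₗ[K] A →ₗ[K] A) (P Q : A →ₗ[K] A)
    (hadm : IsAdmissibleAveraging m P Q)
    (ρ : A →ₗ[K] V →ₗ[K] V) (α β : V →ₗ[K] V)
    (hrep : IsRep m P Q ρ α β) :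
    IsRep m P Q (dualRep ρ) β.dualMap α.dualMap ∧
    IsRep m P Q (dualRep m) Q.dualMap P.dualMap := by
  refine ⟨isRep_dual_aux m P Q hadm.1 ρ α β hrep, isRep_dual_aux m P Q hadm.1 m P Q ?_⟩
  obtain ⟨hc, ha, hP, hQ⟩ := hadm
  refine ⟨ha, hP, hQ, fun x v => ⟨?_, ?_⟩⟩
  · rw [hc (Q x) (P v), (hQ v x).1, hc (P v) x]
  · rw [hc x (P v), (hQ v x).2, hc v (Q x)]

end Theorems
end
end

section
/- Let K be a field, (A,·,P,Q) an admissible averaging commutative algebra over K, V a K-vector space with a bilinear multiplication ·_V, and μ : A → End(V), α,β : V → V linear maps. Define on the direct sum A⊕V the multiplication (x+u)·_d(y+v) = x·y + μ(x)v + μ(y)u + u·_V v and the operators (P+α)(x+u) = P(x)+α(u) and (Q+β)(x+u) = Q(x)+β(u). Then (μ,α,β,V,·_V) is an (A,·,P,Q)-representation algebra if and only if (A⊕V, ·_d, P+α, Q+β) is an admissible averaging commutative algebra. -/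
open TensorProduct

noncomputable section

section Theorems

open Paper

variable {K : Type*} [Field K]
variable {A : Type*} [AddCommGroup A] [Module K A]
variable {V : Type*} [AddCommGroup V] [Module K V]

theorem repAlg_iff_semidirect
    (m : A →ₗ[K] A →ₗ[K] A) (P Q : A →ₗ[K] A)
    (hadm : IsAdmissibleAveraging m P Q)
    (ρ : A →ₗ[K] V →ₗ[K] V) (α β : V →ₗ[K] V) (mV : V →ₗ[K] V →ₗ[K] V) :
    IsRepAlg m P Q ρ α β mV ↔
      IsAdmissibleAveraging (sdMul m ρ mV) (P.prodMap α) (Q.prodMap β) := by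
  have hd : ∀ p q : A × V, sdMul m ρ mV p q
      = (m p.1 q.1, ρ p.1 q.2 + ρ q.1 p.2 + mV p.2 q.2) := fun p q => rfl
  obtain ⟨hc, ha, hP, hQ⟩ := hadm
  constructor
  · rintro ⟨⟨r1, r2, r3, r4⟩, ⟨vc, va, vP, vQ⟩, hm⟩
    have hm2 : ∀ x u v, ρ x (mV u v) = mV u (ρ x v) := fun x u v => by
      rw [vc u v, hm, vc]
    have rc : ∀ x y v, ρ x (ρ y v) = ρ y (ρ x v) := fun x y v => by
      rw [← r1, hc, r1]
    refine ⟨?_, ?_, ?_, ?_⟩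
    · rintro ⟨x, u⟩ ⟨y, v⟩
      simp only [hd, Prod.mk.injEq]
      exact ⟨hc x y, by rw [vc u v]; abel⟩
    · rintro ⟨x, u⟩ ⟨y, v⟩ ⟨z, w⟩
      simp only [hd, Prod.mk.injEq]
      refine ⟨ha x y z, ?_⟩
      simp only [map_add, LinearMap.add_apply, r1, hm]
      rw [rc z x v, rc z y u, ← hm2 z u v, ← hm2 y u w, hm z u v, hm y u w, va u v w]
      abel
    · rintro ⟨x, u⟩ ⟨y, v⟩
      simp only [hd, LinearMap.prodMap_apply, Prod.mk.injEq, map_add]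
      refine ⟨⟨(hP x y).1, ?_⟩, ⟨(hP x y).2, ?_⟩⟩
      · rw [(r2 x v).1, (r2 y u).1, (r2 y u).2, (vP u v).1]
      · rw [(r2 x v).2, (r2 y u).2, (vP u v).2]
    · rintro ⟨x, u⟩ ⟨y, v⟩
      simp only [hd, LinearMap.prodMap_apply, Prod.mk.injEq, map_add]
      refine ⟨⟨(hQ x y).1, ?_⟩, ⟨(hQ x y).2, ?_⟩⟩
      · rw [(r3 x v).1, (r4 y u).1, (vQ u v).1]
      · rw [(r3 x v).2, (r4 y u).2, (vQ u v).2]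
  · rintro ⟨sc, sa, sP, sQ⟩
    refine ⟨⟨?_, ?_, ?_, ?_⟩, ⟨?_, ?_, ?_, ?_⟩, ?_⟩
    · intro x y v
      simpa [hd] using sa (x, 0) (y, 0) (0, v)
    · intro x v
      simpa [hd] using sP (x, 0) (0, v)
    · intro x v
      simpa [hd] using sQ (x, 0) (0, v)
    · intro x v
      simpa [hd] using sQ (0, v) (x, 0)
    · intro u v
      simpa [hd] using sc (0, u) (0, v)
    · intro u v w
      simpa [hd] using sa (0, u) (0, v) (0, w)
    · intro u v
      simpa [hd] using sP (0, u) (0, v)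
    · intro u v
      simpa [hd] using sQ (0, u) (0, v)
    · intro x u v
      simpa [hd] using (sa (x, 0) (0, u) (0, v)).symm

end Theorems
end
end

section
/- Let K be a field and (A,·,P,Q) a finite-dimensional admissible averaging commutative algebra over K. Let s ∈ A⊗A be symmetric (τ(s) = s) and invariant on (A,·), and suppose (P⊗id − id⊗Q)(s) = 0. Define a multiplication on A* by a*◇_s b* = L*(s♯(a*))(b*). Then: ◇_s is commutative and associative; (A*, ◇_s, Q*, P*) is an admissible averaging commutative algebra (in particular Q* is an averaging operator of (A*,◇_s)); L*(x)(a*◇_s b*) = (L*(x)(a*))◇_s b* for all x ∈ A and a*,b* ∈ A*; and (L*, Q*, P*, A*) is a representation of (A,·,P,Q). That is, (L*,Q*,P*,A*,◇_s) is an (A,·,P,Q)-representation algebra. -/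
open TensorProduct

noncomputable section

section Theorems

open Paper

variable {K : Type*} [Field K]
variable {A : Type*} [AddCommGroup A] [Module K A]
variable {V : Type*} [AddCommGroup V] [Module K V]

theorem sharp_rTensor (f : A →ₗ[K] A) (s : A ⊗[K] A) (a : Module.Dual K A) :
    sharp (LinearMap.rTensor A f s) a = sharp s (f.dualMap a) := by
  induction s with
  | zero => simp [sharp]
  | tmul u v => simp [sharp]
  | add u v hu hv => simp_all [sharp]

theorem sharp_lTensor (f : A →ₗ[K] A) (s : A ⊗[K] A) (a : Module.Dual K A) :
    sharp (LinearMap.lTensor A f s) a = f (sharp s a) := by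
  induction s with
  | zero => simp [sharp]
  | tmul u v => simp [sharp]
  | add u v hu hv => simp_all [sharp]

theorem sharp_comm (s : A ⊗[K] A) (a b : Module.Dual K A) :
    b (sharp (TensorProduct.comm K A A s) a) = a (sharp s b) := by
  induction s with
  | zero => simp [sharp]
  | tmul u v => simp [sharp, mul_comm]
  | add u v hu hv => simp_all [sharp]

theorem dual_repAlg_of_invariant [FiniteDimensional K A]
    (m : A →ₗ[K] A →ₗ[K] A) (P Q : A →ₗ[K] A)
    (hadm : IsAdmissibleAveraging m P Q)
    (s : A ⊗[K] A) (hsymm : TensorProduct.comm K A A s = s)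
    (hinv : IsInvariant m s)
    (hPQ : LinearMap.rTensor A P s = LinearMap.lTensor A Q s) :
    IsRepAlg m P Q (dualRep m) Q.dualMap P.dualMap (diamondMap m s) := by
  obtain ⟨hc, ha, hP, hQ⟩ := hadm
  have hS : ∀ a b : Module.Dual K A, b (sharp s a) = a (sharp s b) := fun a b => by
    have := sharp_comm s a b
    rwa [hsymm] at this
  have hL : ∀ x a, sharp s (dualRep m x a) = m x (sharp s a) := fun x a => by
    have := congrArg (fun t => sharp t a) (hinv x)
    simp only [sharp_rTensor, sharp_lTensor] at this
    exact this.symm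
  have hSP : ∀ a, sharp s (P.dualMap a) = Q (sharp s a) := fun a => by
    have := congrArg (fun t => sharp t a) hPQ
    simpa only [sharp_rTensor, sharp_lTensor] using this
  have hSQ : ∀ a, sharp s (Q.dualMap a) = P (sharp s a) := fun a => by
    rw [← sub_eq_zero, ← Module.forall_dual_apply_eq_zero_iff K]
    intro b
    have h := congrArg a (hSP b)
    have h1 := hS b (Q.dualMap a)
    have h2 := hS a (P.dualMap b)
    have h3 := hS (Q.dualMap a) b
    rw [map_sub, sub_eq_zero, h3]
    change a (Q (sharp s b)) = (P.dualMap b) (sharp s a)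
    rw [h2, h]
  have hd : ∀ x (a : Module.Dual K A) y, dualRep m x a y = a (m x y) := fun _ _ _ => rfl
  have hdm : ∀ (f : A →ₗ[K] A) (a : Module.Dual K A) y, f.dualMap a y = a (f y) :=
    fun _ _ _ => rfl
  have hmV : ∀ a b, diamondMap m s a b = dualRep m (sharp s a) b := fun _ _ => rfl
  have hr1 : ∀ x y v, dualRep m (m x y) v = dualRep m x (dualRep m y v) := fun x y v => by
    ext z
    simp only [hd]
    rw [hc x y, ha]
  have hrep : IsRep m P Q (dualRep m) Q.dualMap P.dualMap := by
    refine ⟨hr1, fun x v => ⟨?_, ?_⟩, fun x v => ⟨?_, ?_⟩, fun x v => ⟨?_, ?_⟩⟩ <;> ext y <;>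
      simp only [hd, hdm]
    · rw [(hQ x y).1]
    · rw [(hQ x y).1, (hQ x y).2]
    · rw [(hP x y).1]
    · rw [(hP x y).1, (hP x y).2]
    · rw [hc (Q x) y, ← (hQ y x).2, hc x]
    · rw [hc (Q x), (hQ y x).1, hc x]
  refine ⟨hrep, ⟨?_, ?_, ?_, ?_⟩, ?_⟩
  · intro a b
    ext y
    simp only [hmV, hd]
    rw [hc, ← hL, hS, hd, hc]
  · intro a b c
    simp only [hmV]
    rw [hL, hr1]
  · intro a b
    simp only [hmV, hSQ]
    exact hrep.2.1 _ _
  · intro a b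
    simp only [hmV, hSQ]
    exact hrep.2.2.1 _ _
  · intro x a b
    simp only [hmV, hL, hr1]

end Theorems
end
end

section
/- Let K be a field and (A,·,P,Q) a finite-dimensional admissible averaging commutative algebra over K. Let r ∈ A⊗A be such that r+τ(r) is invariant on (A,·). Then the following are equivalent: (1) r is a solution of the AAYBE in (A,·,P,Q); (2) for all a*,b* ∈ A*: r♯(a*)·r♯(b*) = r♯( L*(r♯(a*))(b*) + L*(r♯(b*))(a*) − L*((r+τ(r))♯(a*))(b*) ), and P∘r♯ = r♯∘Q* and Q∘r♯ = r♯∘P*. -/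
open TensorProduct

noncomputable section

namespace Paper

section Helpers

variable {K : Type*} [Field K] {A : Type*} [AddCommGroup A] [Module K A]
variable {M : Type*} [AddCommGroup M] [Module K M]

/-- Contraction of the first tensor factor. -/
def ctr (a : Module.Dual K A) : A ⊗[K] M →ₗ[K] M :=
  (TensorProduct.lid K M).toLinearMap ∘ₗ LinearMap.rTensor M a

lemma ctr_tmul (a : Module.Dual K A) (x : A) (y : M) : ctr a (x ⊗ₜ[K] y) = a x • y := by
  simp [ctr]

lemma sharp_eq (r : A ⊗[K] A) (a : Module.Dual K A) : sharp r a = ctr a r := rfl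

lemma ctr_expand [FiniteDimensional K A] (t : A ⊗[K] M) :
    t = ∑ i, (Module.finBasis K A) i ⊗ₜ[K] ctr ((Module.finBasis K A).coord i) t := by
  induction t with
  | zero => simp
  | add x y hx hy =>
    conv_lhs => rw [hx, hy]
    simp only [map_add, tmul_add, Finset.sum_add_distrib]
  | tmul x y =>
    simp only [ctr_tmul, ← smul_tmul, Module.Basis.coord_apply]
    rw [← sum_tmul, Module.Basis.sum_repr]

lemma ctr_ext [FiniteDimensional K A] {t t' : A ⊗[K] M}
    (h : ∀ a : Module.Dual K A, ctr a t = ctr a t') : t = t' := by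
  rw [ctr_expand t, ctr_expand t']
  simp only [h]

lemma ctr_rTensor (P : A →ₗ[K] A) (a : Module.Dual K A) (r : A ⊗[K] M) :
    ctr a (LinearMap.rTensor M P r) = ctr (P.dualMap a) r := by
  induction r with
  | zero => simp
  | add x y hx hy => simp only [map_add, hx, hy]
  | tmul x y => simp [ctr_tmul]

lemma ctr_lTensor (P : M →ₗ[K] M) (a : Module.Dual K A) (r : A ⊗[K] M) :
    ctr a (LinearMap.lTensor A P r) = P (ctr a r) := by
  induction r with
  | zero => simp
  | add x y hx hy => simp only [map_add, hx, hy]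
  | tmul x y => simp [ctr_tmul]

lemma ctr_add (a b : Module.Dual K A) (r : A ⊗[K] M) :
    ctr (a + b) r = ctr a r + ctr b r := by
  induction r with
  | zero => simp
  | add x y hx hy => simp only [map_add, hx, hy]; abel
  | tmul x y => simp [ctr_tmul, add_smul]

lemma ctr_tau (a b : Module.Dual K A) (r : A ⊗[K] A) :
    b (ctr a (tau r)) = a (ctr b r) := by
  unfold tau
  induction r with
  | zero => simp
  | add x y hx hy => simp only [map_add, hx, hy]
  | tmul x y => simp [ctr_tmul, mul_comm]

lemma ctr_place3 (m : A →ₗ[K] A →ₗ[K] A) (a b : Module.Dual K A) (r r' : A ⊗[K] A) :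
    ctr b (ctr a (place3 (liftM m) (r ⊗ₜ[K] r'))) = m (ctr a r) (ctr b r') := by
  induction r with
  | zero => simp
  | add x y hx hy => simp only [add_tmul, map_add, LinearMap.add_apply, hx, hy]
  | tmul x y =>
    induction r' with
    | zero => simp
    | add x y hx hy => simp only [tmul_add, map_add, hx, hy]
    | tmul z w => simp [ctr_tmul, place3, liftM, smul_smul, mul_comm]

lemma ctr_place2 (m : A →ₗ[K] A →ₗ[K] A) (hm : IsComm m) (a b : Module.Dual K A)
    (r r' : A ⊗[K] A) :
    ctr b (ctr a (place2 (flipM m) (r ⊗ₜ[K] r'))) = ctr ((m (ctr a r)).dualMap b) r' := by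
  induction r' with
  | zero => simp
  | add x y hx hy => simp only [tmul_add, map_add, hx, hy]
  | tmul z w =>
    rw [ctr_tmul, LinearMap.dualMap_apply]
    induction r with
    | zero => simp
    | add x y hx hy =>
      simp only [add_tmul, map_add, LinearMap.add_apply, hx, hy, add_smul]
    | tmul x y => simp [ctr_tmul, place2, flipM, smul_smul, hm z y]

lemma ctr_place1 (m : A →ₗ[K] A →ₗ[K] A) (a b : Module.Dual K A)
    (r r' : A ⊗[K] A) :
    ctr b (ctr a (place1 (liftM m) (r ⊗ₜ[K] r'))) =
      ctr ((m (ctr b (tau r))).dualMap a) r' := by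
  unfold tau
  induction r' with
  | zero => simp
  | add x y hx hy => simp only [tmul_add, map_add, hx, hy]
  | tmul z w =>
    rw [ctr_tmul, LinearMap.dualMap_apply]
    induction r with
    | zero => simp
    | add x y hx hy =>
      simp only [add_tmul, map_add, LinearMap.add_apply, hx, hy, add_smul]
    | tmul x y => simp [ctr_tmul, place1, liftM, smul_smul, mul_comm]

lemma tau_symm (r : A ⊗[K] A) : tau (r + tau r) = r + tau r := by
  have h : tau (tau r) = r := by
    unfold tau
    induction r with
    | zero => simp
    | add x y hx hy => simp only [map_add, hx, hy]
    | tmul x y => simp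
  have h2 : tau (r + tau r) = tau r + tau (tau r) := by simp [tau]
  rw [h2, h, add_comm]

lemma inv_symm (m : A →ₗ[K] A →ₗ[K] A) (hm : IsComm m) (s : A ⊗[K] A)
    (hs : IsInvariant m s) (ht : tau s = s) (a b : Module.Dual K A) :
    (m (ctr a s)).dualMap b = (m (ctr b s)).dualMap a := by
  ext x
  rw [LinearMap.dualMap_apply, LinearMap.dualMap_apply, hm, hm _ x,
    ← ctr_lTensor, hs x, ctr_rTensor]
  conv_lhs => rw [← ht]
  rw [ctr_tau, LinearMap.dualMap_apply]

end Helpers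

end Paper

section Theorems

open Paper

variable {K : Type*} [Field K]
variable {A : Type*} [AddCommGroup A] [Module K A]
variable {V : Type*} [AddCommGroup V] [Module K V]

theorem aaybe_iff_Ooperator [FiniteDimensional K A]
    (m : A →ₗ[K] A →ₗ[K] A) (P Q : A →ₗ[K] A)
    (hadm : IsAdmissibleAveraging m P Q)
    (r : A ⊗[K] A) (hinv : IsInvariant m (r + tau r)) :
    IsAAYBESolution m P Q r ↔
      ((∀ a b : Module.Dual K A,
          m (sharp r a) (sharp r b) =
            sharp r ((m (sharp r a)).dualMap b + (m (sharp r b)).dualMap a -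
              (m (sharp (r + tau r) a)).dualMap b)) ∧
        P ∘ₗ sharp r = sharp r ∘ₗ Q.dualMap ∧ Q ∘ₗ sharp r = sharp r ∘ₗ P.dualMap) := by
  obtain ⟨hm, -, -, -⟩ := hadm
  have key : ∀ a b : Module.Dual K A, ctr b (ctr a (Acal m r)) =
      m (sharp r a) (sharp r b) -
            sharp r ((m (sharp r a)).dualMap b + (m (sharp r b)).dualMap a -
              (m (sharp (r + tau r) a)).dualMap b) := by
    intro a b
    have h1 := inv_symm m hm _ hinv (tau_symm r) a b
    have h2 : (m (ctr b (tau r))).dualMap a =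
        (m (ctr b (r + tau r))).dualMap a - (m (ctr b r)).dualMap a := by
      ext x
      simp
    simp only [← sharp_eq] at h1 h2
    simp only [Acal, map_add, map_sub, ctr_place1, ctr_place2 m hm, ctr_place3]
    simp only [← sharp_eq]
    rw [h2, h1, map_sub]
    abel
  have op : ∀ S T : A →ₗ[K] A, LinearMap.rTensor A S r = LinearMap.lTensor A T r ↔
      T ∘ₗ sharp r = sharp r ∘ₗ S.dualMap := by
    intro S T
    constructor
    · intro h
      ext a
      simp only [LinearMap.comp_apply, sharp_eq]
      rw [← ctr_rTensor, h, ctr_lTensor]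
    · intro h
      apply ctr_ext
      intro a
      rw [ctr_rTensor, ctr_lTensor]
      exact (LinearMap.congr_fun h a).symm
  unfold IsAAYBESolution
  rw [op, op, and_comm (a := Q ∘ₗ _ = _)]
  refine and_congr_left fun _ => ?_
  constructor
  · intro h a b
    have := key a b
    rw [h, map_zero, map_zero] at this
    exact sub_eq_zero.mp this.symm
  · intro h
    apply ctr_ext
    intro a
    apply ctr_ext
    intro b
    rw [key, h a b, sub_self, map_zero, map_zero]

end Theorems
end
end

section
/- Let K be a field and (A,·,P,Q) a finite-dimensional admissible averaging commutative algebra over K such that (A,·,B) is a symmetric Frobenius commutative algebra. Let r ∈ A⊗A be such that r+τ(r) is invariant on (A,·), and define R : A → A by R(x) = r♯(B♮(x)). Then r is a solution of the AAYBE in (A,·,P,Q) if and only if: R(x)·R(y) = R( R(x)·y + x·R(y) − x·((r+τ(r))♯(B♮(y))) ) for all x,y ∈ A, and P∘R = R∘Q̂ and Q∘R = R∘P̂, where P̂, Q̂ are the adjoints of P, Q with respect to B. -/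
open TensorProduct

noncomputable section

section Theorems

open Paper

variable {K : Type*} [Field K]
variable {A : Type*} [AddCommGroup A] [Module K A]
variable {V : Type*} [AddCommGroup V] [Module K V]

theorem contr_zero [FiniteDimensional K A] {M : Type*} [AddCommGroup M] [Module K M]
    (T : A ⊗[K] M)
    (h : ∀ f : Module.Dual K A, TensorProduct.lid K M (LinearMap.rTensor M f T) = 0) : T = 0 := by
  let b := Module.finBasis K A
  have key : ∀ T : A ⊗[K] M,
      ∑ i, b i ⊗ₜ[K] TensorProduct.lid K M (LinearMap.rTensor M (b.coord i) T) = T := by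
    intro T
    induction T with
    | zero => simp
    | add s t hs ht =>
      conv_rhs => rw [← hs, ← ht]
      simp only [map_add, TensorProduct.tmul_add, Finset.sum_add_distrib]
    | tmul a v =>
      simp only [LinearMap.rTensor_tmul, TensorProduct.lid_tmul, ← TensorProduct.smul_tmul]
      rw [← TensorProduct.sum_tmul]
      congr 1
      exact b.sum_repr a
  rw [← key T]
  simp [h]

theorem sharp_tmul (u v : A) (f : Module.Dual K A) : sharp (u ⊗ₜ[K] v) f = f u • v := by
  simp [sharp]

theorem sharp_add' (s t : A ⊗[K] A) : sharp (s + t) = sharp s + sharp t := by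
  ext f; simp [sharp]

theorem sharp_sub' (s t : A ⊗[K] A) : sharp (s - t) = sharp s - sharp t := by
  ext f; simp [sharp]

theorem sharp_zero' : sharp (0 : A ⊗[K] A) = 0 := by
  ext f; simp [sharp]

theorem tau_add' (s t : A ⊗[K] A) : tau (s + t) = tau s + tau t := by
  simp [tau]

/-- Contraction of the first leg. -/
def contr (M : Type*) [AddCommGroup M] [Module K M] (f : Module.Dual K A) : A ⊗[K] M →ₗ[K] M :=
  (TensorProduct.lid K M).toLinearMap ∘ₗ LinearMap.rTensor M f

theorem contr_tmul (M : Type*) [AddCommGroup M] [Module K M] (f : Module.Dual K A) (a : A) (v : M) :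
    contr M f (a ⊗ₜ[K] v) = f a • v := by
  simp [contr]

theorem sharp_eq (s : A ⊗[K] A) (f : Module.Dual K A) : sharp s f = contr A f s := rfl

theorem p1 (m : A →ₗ[K] A →ₗ[K] A) (B : A →ₗ[K] A →ₗ[K] K) 
    (hB : ∀ x y z, B (m x y) z = B x (m y z)) (x y : A) (s t : A ⊗[K] A) :
    contr A (B y) (contr (A ⊗[K] A) (B x) (place1 (liftM m) (s ⊗ₜ[K] t))) =
      sharp t (B (m x (sharp (tau s) (B y)))) := by
  induction s with
  | zero => simp [tau, sharp_zero']
  | add s s' hs hs' =>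
    simp only [TensorProduct.add_tmul, map_add, hs, hs', tau_add', sharp_add', LinearMap.add_apply]
  | tmul u v =>
    induction t with
    | zero => simp [sharp_zero']
    | add s s' hs hs' =>
      simp only [TensorProduct.tmul_add, map_add, hs, hs', sharp_add', LinearMap.add_apply]
    | tmul u' v' =>
      simp [place1, Paper.liftM, contr_tmul, sharp_tmul, tau, hB, smul_smul, mul_comm]

theorem p2 (m : A →ₗ[K] A →ₗ[K] A) (B : A →ₗ[K] A →ₗ[K] K) (hm : IsComm m)
    (hB : ∀ x y z, B (m x y) z = B x (m y z)) (x y : A) (s t : A ⊗[K] A) :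
    contr A (B y) (contr (A ⊗[K] A) (B x) (place2 (flipM m) (s ⊗ₜ[K] t))) =
      sharp t (B (m (sharp s (B x)) y)) := by
  induction s with
  | zero => simp [sharp_zero']
  | add s s' hs hs' =>
    simp only [TensorProduct.add_tmul, map_add, hs, hs', sharp_add', LinearMap.add_apply]
  | tmul u v =>
    induction t with
    | zero => simp [sharp_zero']
    | add s s' hs hs' =>
      simp only [TensorProduct.tmul_add, map_add, hs, hs', sharp_add', LinearMap.add_apply]
    | tmul u' v' =>
      simp [place2, flipM, contr_tmul, sharp_tmul, hm v y, hm u' v, hB, smul_smul, mul_comm]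

theorem p3 (m : A →ₗ[K] A →ₗ[K] A) (B : A →ₗ[K] A →ₗ[K] K) (x y : A) (s t : A ⊗[K] A) :
    contr A (B y) (contr (A ⊗[K] A) (B x) (place3 (liftM m) (s ⊗ₜ[K] t))) =
      m (sharp s (B x)) (sharp t (B y)) := by
  induction s with
  | zero => simp [sharp_zero']
  | add s s' hs hs' =>
    simp only [TensorProduct.add_tmul, map_add, hs, hs', sharp_add', LinearMap.add_apply]
  | tmul u v =>
    induction t with
    | zero => simp [sharp_zero']
    | add s s' hs hs' =>
      simp only [TensorProduct.tmul_add, map_add, hs, hs', sharp_add', LinearMap.add_apply]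
    | tmul u' v' =>
      simp [place3, Paper.liftM, contr_tmul, sharp_tmul, smul_smul, mul_comm]

theorem pl (Q : A →ₗ[K] A) (f : Module.Dual K A) (r : A ⊗[K] A) :
    contr A f (LinearMap.lTensor A Q r) = Q (sharp r f) := by
  induction r with
  | zero => simp [sharp_zero']
  | add s s' hs hs' => simp only [map_add, hs, hs', sharp_add', LinearMap.add_apply]
  | tmul u v => simp [contr_tmul, sharp_tmul]

theorem pr (P : A →ₗ[K] A) (f : Module.Dual K A) (r : A ⊗[K] A) :
    contr A f (LinearMap.rTensor A P r) = sharp r (f ∘ₗ P) := by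
  induction r with
  | zero => simp [sharp_zero']
  | add s s' hs hs' => simp only [map_add, hs, hs', sharp_add', LinearMap.add_apply]
  | tmul u v => simp [contr_tmul, sharp_tmul]

theorem contr_inj [FiniteDimensional K A] {M : Type*} [AddCommGroup M] [Module K M]
    (B : A →ₗ[K] A →ₗ[K] K) (hB : IsNondeg B) (S T : A ⊗[K] M) :
    S = T ↔ ∀ x, contr M (B x) S = contr M (B x) T := by
  refine ⟨fun h x => by rw [h], fun h => ?_⟩
  have hinj : Function.Injective B := by
    rw [injective_iff_map_eq_zero]
    intro x hx
    exact hB x (fun y => by rw [hx]; rfl)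
  have hsurj : Function.Surjective B :=
    (LinearMap.injective_iff_surjective_of_finrank_eq_finrank
      (Subspace.dual_finrank_eq (K := K) (V := A)).symm).1 hinj
  rw [← sub_eq_zero]
  apply contr_zero
  intro f
  obtain ⟨x, rfl⟩ := hsurj f
  have := h x
  simp only [contr, LinearMap.comp_apply, LinearEquiv.coe_coe] at this
  rw [map_sub, map_sub, this, sub_self]

theorem aaybe_iff_RotaBaxter_like [FiniteDimensional K A]
    (m : A →ₗ[K] A →ₗ[K] A) (P Q : A →ₗ[K] A)
    (hadm : IsAdmissibleAveraging m P Q)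
    (B : A →ₗ[K] A →ₗ[K] K) (hFrob : IsSymFrob m B)
    (r : A ⊗[K] A) (hinv : IsInvariant m (r + tau r))
    (Phat Qhat : A →ₗ[K] A)
    (hPhat : ∀ x y, B (Phat x) y = B x (P y))
    (hQhat : ∀ x y, B (Qhat x) y = B x (Q y))
    (R : A →ₗ[K] A) (hR : ∀ x, R x = sharp r (B x)) :
    IsAAYBESolution m P Q r ↔
      ((∀ x y, m (R x) (R y) =
          R (m (R x) y + m x (R y) - m x (sharp (r + tau r) (B y)))) ∧
        P ∘ₗ R = R ∘ₗ Qhat ∧ Q ∘ₗ R = R ∘ₗ Phat) := by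
  obtain ⟨hm, -, hsymm, hnd, hB⟩ := hFrob
  have key : ∀ P Q Phat : A →ₗ[K] A, (∀ x y, B (Phat x) y = B x (P y)) →
      (LinearMap.rTensor A P r = LinearMap.lTensor A Q r ↔ Q ∘ₗ R = R ∘ₗ Phat) := by
    intro P Q Phat h
    rw [contr_inj B hnd, LinearMap.ext_iff]
    refine forall_congr' fun x => ?_
    have h' : (B x) ∘ₗ P = B (Phat x) := by ext y; simp [h]
    rw [pl, pr, h', LinearMap.comp_apply, LinearMap.comp_apply, hR, hR]
    exact eq_comm
  unfold IsAAYBESolution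
  rw [key P Q Phat hPhat, key Q P Qhat hQhat, and_comm (a := Q ∘ₗ R = _)]
  refine and_congr_left fun _ => ?_
  rw [contr_inj B hnd]
  refine forall_congr' fun x => ?_
  rw [contr_inj B hnd]
  refine forall_congr' fun y => ?_
  have e : R (m (R x) y + m x (R y) - m x (sharp (r + tau r) (B y))) =
      R (m (R x) y) - R (m x (sharp (tau r) (B y))) := by
    rw [sharp_add', LinearMap.add_apply, ← hR, ← map_sub]
    congr 1
    rw [map_add]
    abel
  rw [e]
  simp only [Acal, map_add, map_sub, map_zero, p1 m B hB, p2 m B hm hB, p3, ← hR]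
  rw [← sub_eq_zero (a := m (R x) (R y))]
  constructor <;> intro h <;> rw [← h] <;> abel

end Theorems
end
end

section
/- Let K be a field, (A,·) a finite-dimensional commutative algebra over K, λ ∈ K, and R a Rota–Baxter operator of weight λ on (A,·). On D = A⊕A* define the multiplication (x+a*)·_d(y+b*) = x·y + L*(x)(b*) + L*(y)(a*), the bilinear form B_d(x+a*, y+b*) = ⟨a*,y⟩ + ⟨b*,x⟩, and the operator R_d(x+a*) = R(x) − (R+λ·id_A)*(a*). Then (D, ·_d, R_d, B_d) is a symmetric Rota–Baxter Frobenius commutative algebra of weight λ. -/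
open TensorProduct

noncomputable section

section Theorems

open Paper

variable {K : Type*} [Field K]
variable {A : Type*} [AddCommGroup A] [Module K A]
variable {V : Type*} [AddCommGroup V] [Module K V]

theorem semidirect_symRBFrob [FiniteDimensional K A]
    (m : A →ₗ[K] A →ₗ[K] A) (hcomm : IsComm m) (hassoc : IsAssoc m)
    (l : K) (R : A →ₗ[K] A) (hR : IsRB m R l) :
    IsSymRBFrob (sdMul m (dualRep m) 0)
      (LinearMap.prodMap R (-((R + l • LinearMap.id).dualMap)))
      pairForm l := by
  have hs : ∀ p q : A × Module.Dual K A, sdMul m (dualRep m) 0 p q =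
      (m p.1 q.1, dualRep m p.1 q.2 + dualRep m q.1 p.2) := by
    intro p q
    simp [sdMul]
  have hd : ∀ (x : A) (a : Module.Dual K A) (z : A), dualRep m x a z = a (m x z) := by
    intro x a z
    rfl
  have hp : ∀ p q : A × Module.Dual K A, pairForm p q = p.2 q.1 + q.2 p.1 := by
    intro p q
    rfl
  have key : ∀ x z, m (R x) (R z) = R (m (R x) z) + R (m x (R z)) + l • R (m x z) := by
    intro x z
    rw [hR x z]
    simp
  refine ⟨⟨?_, ?_, ?_, ?_, ?_⟩, ?_, ?_⟩
  · rintro ⟨x, a⟩ ⟨y, b⟩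
    rw [hs, hs]
    exact Prod.ext (hcomm x y) (add_comm _ _)
  · rintro ⟨x, a⟩ ⟨y, b⟩ ⟨z, c⟩
    simp only [hs]
    refine Prod.ext (hassoc x y z) ?_
    ext w
    simp only [LinearMap.add_apply, hd]
    have h1 : m y (m x w) = m x (m y w) := by
      rw [← hassoc, hcomm y x, hassoc]
    have h2 : m x (m z w) = m z (m x w) := by
      rw [← hassoc, hcomm x z, hassoc]
    have h3 : m y (m z w) = m z (m y w) := by
      rw [← hassoc, hcomm y z, hassoc]
    simp only [hassoc x y w, hassoc y z w, map_add, LinearMap.add_apply, hd, h1, h2, h3]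
    ring
  · rintro ⟨x, a⟩ ⟨y, b⟩
    simp only [hp]
    ring
  · rintro ⟨x, a⟩ h
    refine Prod.ext ?_ ?_
    · refine (Module.forall_dual_apply_eq_zero_iff K x).1 fun f => ?_
      simpa [hp] using h (0, f)
    · ext y
      simpa [hp] using h (y, 0)
  · rintro ⟨x, a⟩ ⟨y, b⟩ ⟨z, c⟩
    simp only [hs, hp, LinearMap.add_apply, hd]
    rw [hcomm y x, hcomm z x]
    ring
  · rintro ⟨x, a⟩ ⟨y, b⟩
    simp only [hs, LinearMap.prodMap_apply]
    refine Prod.ext (by simpa using hR x y) ?_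
    ext z
    have e1 := congrArg b (key x z)
    have e2 := congrArg a (key y z)
    simp only [map_add, map_smul, smul_eq_mul] at e1 e2
    simp [hd]
    linear_combination e1 + e2
  · rintro ⟨x, a⟩ ⟨y, b⟩
    simp [hp]
    ring

end Theorems
end
end

section
/- Let K be a field and (A,·,R,B) a finite-dimensional symmetric Rota–Baxter Frobenius commutative algebra of weight 0 over K. Suppose (A,·,P,Q) is an admissible averaging commutative algebra satisfying P∘R = R∘Q̂ and Q∘R = R∘P̂, where P̂, Q̂ are the adjoints of P, Q with respect to B. Define r ∈ A⊗A by r♯(a*) = R(B♮⁻¹(a*)) for all a* ∈ A*. Then r is skew-symmetric (r + τ(r) = 0) and r is a solution of the AAYBE in (A,·,P,Q). -/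
open TensorProduct

noncomputable section

section Theorems

open Paper

variable {K : Type*} [Field K]
variable {A : Type*} [AddCommGroup A] [Module K A]
variable {V : Type*} [AddCommGroup V] [Module K V]

theorem hlp_ext {N : Type*} [AddCommGroup N] [Module K N] [FiniteDimensional K A]
    (B : A →ₗ[K] A →ₗ[K] K) (hB : IsNondeg B) (t : A ⊗[K] N)
    (h : ∀ x, TensorProduct.lid K N (LinearMap.rTensor N (B x) t) = 0) : t = 0 := by
  have hinj : Function.Injective B := by
    rw [← LinearMap.ker_eq_bot, LinearMap.ker_eq_bot']
    intro x hx
    exact hB x (fun y => by rw [hx]; rfl)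
  have hsurj : Function.Surjective B :=
    (LinearMap.injective_iff_surjective_of_finrank_eq_finrank
      (Subspace.dual_finrank_eq (K := K) (V := A)).symm).1 hinj
  let b := Module.finBasis K A
  have key : ∀ t : A ⊗[K] N,
      t = ∑ i, b i ⊗ₜ[K] TensorProduct.lid K N (LinearMap.rTensor N (b.coord i) t) := by
    intro t
    induction t using TensorProduct.induction_on with
    | zero => simp
    | add s t hs ht =>
      simp only [map_add, TensorProduct.tmul_add, Finset.sum_add_distrib]
      rw [← hs, ← ht]
    | tmul u v =>
      simp only [LinearMap.rTensor_tmul, TensorProduct.lid_tmul, TensorProduct.tmul_smul,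
        ← TensorProduct.smul_tmul', Module.Basis.coord_apply]
      conv_lhs => rw [← b.sum_repr u, TensorProduct.sum_tmul]
      simp only [TensorProduct.smul_tmul']
  rw [key t]
  refine Finset.sum_eq_zero fun i _ => ?_
  obtain ⟨x, hx⟩ := hsurj (b.coord i)
  rw [← hx, h x, TensorProduct.tmul_zero]

/-- `u ⊗ v ↦ B(x,u) v`. -/
def hlpL (B : A →ₗ[K] A →ₗ[K] K) (x : A) : A ⊗[K] A →ₗ[K] A :=
  (TensorProduct.lid K A).toLinearMap ∘ₗ LinearMap.rTensor A (B x)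

/-- `u ⊗ v ↦ B(x,v) u`. -/
def hlpR (B : A →ₗ[K] A →ₗ[K] K) (x : A) : A ⊗[K] A →ₗ[K] A :=
  (TensorProduct.rid K A).toLinearMap ∘ₗ LinearMap.lTensor A (B x)

/-- `u ⊗ v ⊗ w ↦ B(x,u) B(y,v) w`. -/
def hlpD (B : A →ₗ[K] A →ₗ[K] K) (x y : A) : A ⊗[K] (A ⊗[K] A) →ₗ[K] A :=
  hlpL B y ∘ₗ (TensorProduct.lid K (A ⊗[K] A)).toLinearMap ∘ₗ LinearMap.rTensor (A ⊗[K] A) (B x)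

theorem hlpL_tmul (B : A →ₗ[K] A →ₗ[K] K) (x u v : A) : hlpL B x (u ⊗ₜ v) = B x u • v := by
  simp [hlpL]

theorem hlpR_tmul (B : A →ₗ[K] A →ₗ[K] K) (x u v : A) : hlpR B x (u ⊗ₜ v) = B x v • u := by
  simp [hlpR]

theorem hlpD_tmul (B : A →ₗ[K] A →ₗ[K] K) (x y u v w : A) :
    hlpD B x y (u ⊗ₜ (v ⊗ₜ w)) = B x u • B y v • w := by
  simp [hlpD, hlpL]

theorem hlpL_add (B : A →ₗ[K] A →ₗ[K] K) (x y : A) (s : A ⊗[K] A) :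
    hlpL B (x + y) s = hlpL B x s + hlpL B y s := by
  simp [hlpL, LinearMap.rTensor_add]

theorem hlpL_smul (B : A →ₗ[K] A →ₗ[K] K) (c : K) (y : A) (s : A ⊗[K] A) :
    hlpL B (c • y) s = c • hlpL B y s := by
  simp [hlpL, LinearMap.rTensor_smul]

theorem hlpL_zero (B : A →ₗ[K] A →ₗ[K] K) (s : A ⊗[K] A) :
    hlpL B 0 s = 0 := by
  simp [hlpL]

theorem hlp_p1 (m : A →ₗ[K] A →ₗ[K] A) (B : A →ₗ[K] A →ₗ[K] K)
    (hinv : ∀ x y z, B (m x y) z = B x (m y z)) (x y : A) (r s : A ⊗[K] A) :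
    hlpD B x y (place1 (liftM m) (r ⊗ₜ[K] s)) = hlpL B (m x (hlpR B y r)) s := by
  induction r using TensorProduct.induction_on with
  | zero => simp [hlpL_zero]
  | add a b ha hb => simp only [TensorProduct.add_tmul, map_add, hlpL_add, ha, hb]
  | tmul u v =>
    induction s using TensorProduct.induction_on with
    | zero => simp
    | add a b ha hb => simp only [TensorProduct.tmul_add, map_add, ha, hb]
    | tmul u' v' =>
      simp [place1, Paper.liftM, hlpD_tmul, hlpL_tmul, hlpR_tmul, hinv, smul_smul, mul_comm]

theorem hlp_p2 (m : A →ₗ[K] A →ₗ[K] A) (B : A →ₗ[K] A →ₗ[K] K) (hc : IsComm m)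
    (hinv : ∀ x y z, B (m x y) z = B x (m y z)) (x y : A) (r s : A ⊗[K] A) :
    hlpD B x y (place2 (flipM m) (r ⊗ₜ[K] s)) = hlpL B (m y (hlpL B x r)) s := by
  induction r using TensorProduct.induction_on with
  | zero => simp [hlpL_zero]
  | add a b ha hb => simp only [TensorProduct.add_tmul, map_add, hlpL_add, ha, hb]
  | tmul u v =>
    induction s using TensorProduct.induction_on with
    | zero => simp
    | add a b ha hb => simp only [TensorProduct.tmul_add, map_add, ha, hb]
    | tmul u' v' =>
      simp [place2, flipM, hlpD_tmul, hlpL_tmul, hinv, smul_smul, hc u' v]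

theorem hlp_p3 (m : A →ₗ[K] A →ₗ[K] A) (B : A →ₗ[K] A →ₗ[K] K) (x y : A) (r s : A ⊗[K] A) :
    hlpD B x y (place3 (liftM m) (r ⊗ₜ[K] s)) = m (hlpL B x r) (hlpL B y s) := by
  induction r using TensorProduct.induction_on with
  | zero => simp
  | add a b ha hb => simp only [TensorProduct.add_tmul, map_add, LinearMap.add_apply, ha, hb]
  | tmul u v =>
    induction s using TensorProduct.induction_on with
    | zero => simp
    | add a b ha hb => simp only [TensorProduct.tmul_add, map_add, ha, hb]
    | tmul u' v' =>
      simp [place3, Paper.liftM, hlpD_tmul, hlpL_tmul, smul_smul, mul_comm]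

theorem hlp_adj (B : A →ₗ[K] A →ₗ[K] K) (hs : ∀ x y, B x y = B y x) (x y : A) (r : A ⊗[K] A) :
    B (hlpR B x r) y = B x (hlpL B y r) := by
  induction r using TensorProduct.induction_on with
  | zero => simp
  | add a b ha hb => simp only [map_add, LinearMap.add_apply, ha, hb]
  | tmul u v => simp [hlpL_tmul, hlpR_tmul, hs y u, mul_comm]

theorem hlp_tau (B : A →ₗ[K] A →ₗ[K] K) (x : A) (r : A ⊗[K] A) :
    hlpL B x (tau r) = hlpR B x r := by
  unfold tau
  induction r using TensorProduct.induction_on with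
  | zero => simp
  | add a b ha hb => simp only [map_add, ha, hb]
  | tmul u v => simp [hlpL_tmul, hlpR_tmul]

theorem hlp_rT (B : A →ₗ[K] A →ₗ[K] K) (P Phat : A →ₗ[K] A)
    (hP : ∀ x y, B (Phat x) y = B x (P y)) (x : A) (r : A ⊗[K] A) :
    hlpL B x (LinearMap.rTensor A P r) = hlpL B (Phat x) r := by
  induction r using TensorProduct.induction_on with
  | zero => simp
  | add a b ha hb => simp only [map_add, ha, hb]
  | tmul u v => simp [hlpL_tmul, hP]

theorem hlp_lT (B : A →ₗ[K] A →ₗ[K] K) (Q : A →ₗ[K] A) (x : A) (r : A ⊗[K] A) :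
    hlpL B x (LinearMap.lTensor A Q r) = Q (hlpL B x r) := by
  induction r using TensorProduct.induction_on with
  | zero => simp
  | add a b ha hb => simp only [map_add, ha, hb]
  | tmul u v => simp [hlpL_tmul]

theorem triangular_from_weight_zero [FiniteDimensional K A]
    (m : A →ₗ[K] A →ₗ[K] A) (R : A →ₗ[K] A) (B : A →ₗ[K] A →ₗ[K] K)
    (hFrob : IsSymRBFrob m R B 0)
    (P Q : A →ₗ[K] A) (hadm : IsAdmissibleAveraging m P Q)
    (Phat Qhat : A →ₗ[K] A)
    (hPhat : ∀ x y, B (Phat x) y = B x (P y))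
    (hQhat : ∀ x y, B (Qhat x) y = B x (Q y))
    (h1 : P ∘ₗ R = R ∘ₗ Qhat) (h2 : Q ∘ₗ R = R ∘ₗ Phat)
    (r : A ⊗[K] A) (hr : sharp r ∘ₗ B = R) :
    r + tau r = 0 ∧ IsAAYBESolution m P Q r := by
  obtain ⟨⟨hc, -, hs, hnd, hinv⟩, hRB, hskew⟩ := hFrob
  have hL : ∀ x, hlpL B x r = R x := fun x => by rw [← hr]; rfl
  have hR : ∀ x, hlpR B x r = - R x := by
    intro x
    rw [← sub_eq_zero]
    refine hnd _ fun y => ?_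
    have := hskew x y
    rw [zero_smul, add_zero] at this
    rw [sub_neg_eq_add, map_add, LinearMap.add_apply, hlp_adj B hs, hL, add_comm, this]
  have ext2 : ∀ s t : A ⊗[K] A, (∀ x, hlpL B x s = hlpL B x t) → s = t := by
    intro s t h
    rw [← sub_eq_zero]
    refine hlp_ext B hnd _ fun x => ?_
    change hlpL B x (s - t) = 0
    rw [map_sub, h, sub_self]
  refine ⟨?_, ?_, ?_, ?_⟩
  · apply ext2
    intro x
    rw [map_add, hlp_tau, hL, hR, add_neg_cancel, map_zero]
  · refine hlp_ext B hnd _ fun x => ?_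
    refine ext2 _ _ fun y => ?_
    rw [map_zero]
    change hlpD B x y (Acal m r) = 0
    unfold Acal
    rw [map_add, map_sub, hlp_p1 m B hinv, hlp_p2 m B hc hinv, hlp_p3, hR, hL, hL, hL, hL, hRB,
      zero_smul, add_zero, hc y (R x), map_neg, map_neg, map_add]
    abel
  · apply ext2
    intro x
    rw [hlp_rT B P Phat hPhat, hlp_lT, hL, hL]
    exact (LinearMap.congr_fun h2 x).symm
  · apply ext2
    intro x
    rw [hlp_rT B Q Qhat hQhat, hlp_lT, hL, hL]
    exact (LinearMap.congr_fun h1 x).symm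

end Theorems
end
end

section
/- Let K be a field and (A,·,P,R,B) a finite-dimensional symmetric averaging Rota–Baxter Frobenius commutative algebra of weight 0 over K, and let P̂ be the adjoint of P with respect to B. Then R∘P̂ = P̂∘R, and the element r ∈ A⊗A defined by r♯(a*) = R(B♮⁻¹(a*)) is a skew-symmetric solution of the AAYBE in the admissible averaging commutative algebra (A,·,P,P̂). -/
open TensorProduct

noncomputable section

section Theorems

open Paper

variable {K : Type*} [Field K]
variable {A : Type*} [AddCommGroup A] [Module K A]
variable {V : Type*} [AddCommGroup V] [Module K V]

namespace Aux

/-- pairing of a 2-tensor with two functionals -/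
def pr {M N : Type*} [AddCommGroup M] [Module K M] [AddCommGroup N] [Module K N]
    (f : M →ₗ[K] K) (g : N →ₗ[K] K) : M ⊗[K] N →ₗ[K] K :=
  (TensorProduct.lid K K).toLinearMap ∘ₗ TensorProduct.map f g

theorem pr_tmul {M N : Type*} [AddCommGroup M] [Module K M] [AddCommGroup N] [Module K N]
    (f : M →ₗ[K] K) (g : N →ₗ[K] K) (a : M) (b : N) : pr f g (a ⊗ₜ[K] b) = f a * g b := by
  simp [pr]

theorem ext2 [FiniteDimensional K A] (t s : A ⊗[K] A)
    (h : ∀ f g : A →ₗ[K] K, pr f g t = pr f g s) : t = s := by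
  let b := Module.finBasis K A
  refine (b.tensorProduct b).ext_elem fun ⟨i, j⟩ => ?_
  have key : ∀ u : A ⊗[K] A, (b.tensorProduct b).repr u (i, j) = pr (b.coord i) (b.coord j) u := by
    intro u
    induction u with
    | zero => simp
    | add x y hx hy => simp only [map_add, Finsupp.add_apply, hx, hy]
    | tmul x y => simp [pr_tmul, mul_comm]
  rw [key, key, h]

theorem ext3 [FiniteDimensional K A] (t s : A ⊗[K] (A ⊗[K] A))
    (h : ∀ f g k : A →ₗ[K] K, pr f (pr g k) t = pr f (pr g k) s) : t = s := by
  let b := Module.finBasis K A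
  refine (b.tensorProduct (b.tensorProduct b)).ext_elem fun ⟨i, j, l⟩ => ?_
  have key2 : ∀ u : A ⊗[K] A, (b.tensorProduct b).repr u (j, l) = pr (b.coord j) (b.coord l) u := by
    intro u
    induction u with
    | zero => simp
    | add x y hx hy => simp only [map_add, Finsupp.add_apply, hx, hy]
    | tmul x y => simp [pr_tmul, mul_comm]
  have key : ∀ u : A ⊗[K] (A ⊗[K] A), (b.tensorProduct (b.tensorProduct b)).repr u (i, j, l)
      = pr (b.coord i) (pr (b.coord j) (b.coord l)) u := by
    intro u
    induction u with
    | zero => simp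
    | add x y hx hy => simp only [map_add, Finsupp.add_apply, hx, hy]
    | tmul x y => simp [pr_tmul, mul_comm, key2]
  rw [key, key, h]

theorem sharp_tmul (u v : A) (f : Module.Dual K A) : sharp (u ⊗ₜ[K] v) f = f u • v := by
  simp [sharp]

theorem sharp_add (r s : A ⊗[K] A) (f : Module.Dual K A) :
    sharp (r + s) f = sharp r f + sharp s f := by
  simp [sharp]

theorem sharp_zero (f : Module.Dual K A) : sharp (0 : A ⊗[K] A) f = 0 := by
  simp [sharp]

theorem pr_eq (f g : A →ₗ[K] K) (r : A ⊗[K] A) : pr f g r = g (sharp r f) := by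
  induction r with
  | zero => simp [sharp_zero]
  | add x y hx hy => simp [sharp_add, hx, hy]
  | tmul x y => simp [pr_tmul, sharp_tmul]

theorem pr_tau (f g : A →ₗ[K] K) (r : A ⊗[K] A) : pr f g (tau r) = pr g f r := by
  induction r with
  | zero => simp [tau]
  | add x y hx hy => simp only [tau, map_add] at *; rw [hx, hy]
  | tmul x y => simp [pr_tmul, tau, mul_comm]

theorem tau_add (r s : A ⊗[K] A) : tau (r + s) = tau r + tau s := by simp [tau]
theorem tau_zero : tau (0 : A ⊗[K] A) = 0 := by simp [tau]
theorem tau_tmul (u v : A) : tau (u ⊗ₜ[K] v) = v ⊗ₜ[K] u := by simp [tau]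

theorem pr_rT (f g : A →ₗ[K] K) (P : A →ₗ[K] A) (r : A ⊗[K] A) :
    pr f g (LinearMap.rTensor A P r) = pr (f ∘ₗ P) g r := by
  induction r with
  | zero => simp
  | add x y hx hy => simp only [map_add, hx, hy]
  | tmul x y => simp [pr_tmul]

theorem pr_lT (f g : A →ₗ[K] K) (P : A →ₗ[K] A) (r : A ⊗[K] A) :
    pr f g (LinearMap.lTensor A P r) = pr f (g ∘ₗ P) r := by
  induction r with
  | zero => simp
  | add x y hx hy => simp only [map_add, hx, hy]
  | tmul x y => simp [pr_tmul]

theorem pr_place1 (m : A →ₗ[K] A →ₗ[K] A) (f g k : A →ₗ[K] K) (r s : A ⊗[K] A) :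
    pr f (pr g k) (place1 (liftM m) (r ⊗ₜ[K] s)) = f (m (sharp (tau r) g) (sharp (tau s) k)) := by
  induction r with
  | zero => simp [sharp_zero, tau_zero]
  | add x y hx hy => simp [TensorProduct.add_tmul, sharp_add, tau_add, hx, hy]
  | tmul x y =>
    induction s with
    | zero => simp [sharp_zero, tau_zero]
    | add x y hx hy => simp only [TensorProduct.tmul_add, sharp_add, tau_add, hx, hy, map_add]
    | tmul z w =>
      simp [pr_tmul, sharp_tmul, tau_tmul, place1, Paper.liftM]
      ring

theorem pr_place2 (m : A →ₗ[K] A →ₗ[K] A) (f g k : A →ₗ[K] K) (r s : A ⊗[K] A) :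
    pr f (pr g k) (place2 (flipM m) (r ⊗ₜ[K] s)) = g (m (sharp (tau s) k) (sharp r f)) := by
  induction r with
  | zero => simp [sharp_zero]
  | add x y hx hy => simp [TensorProduct.add_tmul, sharp_add, hx, hy]
  | tmul x y =>
    induction s with
    | zero => simp [sharp_zero, tau_zero]
    | add x y hx hy =>
      simp only [TensorProduct.tmul_add, sharp_add, tau_add, hx, hy, map_add, LinearMap.add_apply]
    | tmul z w =>
      simp [pr_tmul, sharp_tmul, tau_tmul, place2, flipM]
      try first | (left; ring) | ring

theorem pr_place3 (m : A →ₗ[K] A →ₗ[K] A) (f g k : A →ₗ[K] K) (r s : A ⊗[K] A) :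
    pr f (pr g k) (place3 (liftM m) (r ⊗ₜ[K] s)) = k (m (sharp r f) (sharp s g)) := by
  induction r with
  | zero => simp [sharp_zero]
  | add x y hx hy => simp [TensorProduct.add_tmul, sharp_add, hx, hy]
  | tmul x y =>
    induction s with
    | zero => simp [sharp_zero]
    | add x y hx hy => simp only [TensorProduct.tmul_add, sharp_add, hx, hy, map_add]
    | tmul z w =>
      simp [pr_tmul, sharp_tmul, place3, Paper.liftM]
      try ring

end Aux

theorem triangular_from_avg_weight_zero [FiniteDimensional K A]
    (m : A →ₗ[K] A →ₗ[K] A) (P R : A →ₗ[K] A) (B : A →ₗ[K] A →ₗ[K] K)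
    (h : IsSymAvgRBFrob m P R B 0)
    (Phat : A →ₗ[K] A) (hPhat : ∀ x y, B (Phat x) y = B x (P y))
    (r : A ⊗[K] A) (hr : sharp r ∘ₗ B = R) :
    R ∘ₗ Phat = Phat ∘ₗ R ∧ IsAdmissibleAveraging m P Phat ∧
      r + tau r = 0 ∧ IsAAYBESolution m P Phat r := by
  obtain ⟨⟨⟨hc, ha, hs, hn, hf⟩, hRB, hRs⟩, hP, hPR⟩ := h
  have hRB' : ∀ x y, m (R x) (R y) = R (m (R x) y) + R (m x (R y)) := by
    intro x y; have := hRB x y; simpa using this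
  have hRs' : ∀ x y, B (R x) y = - B x (R y) := by
    intro x y; have := hRs x y; simp only [zero_smul, add_zero] at this
    exact eq_neg_of_add_eq_zero_left this
  have hPR' : ∀ x, P (R x) = R (P x) := fun x => LinearMap.congr_fun hPR x
  have hB : ∀ x y, (∀ z, B x z = B y z) → x = y := by
    intro x y hxy
    refine sub_eq_zero.1 (hn _ fun z => ?_)
    simp [hxy z]
  have hsh : ∀ x, sharp r (B x) = R x := fun x => LinearMap.congr_fun hr x
  have hinj : Function.Injective B := by
    intro x y hxy
    exact hB x y fun z => by rw [hxy]
  have hsurj : ∀ f : A →ₗ[K] K, ∃ x, B x = f :=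
    (LinearMap.injective_iff_surjective_of_finrank_eq_finrank
      (Subspace.dual_finrank_eq (K := K) (V := A)).symm).1 hinj
  have h1 : ∀ x, R (Phat x) = Phat (R x) := by
    intro x
    refine hB _ _ fun z => ?_
    rw [hRs', hPhat, hPhat, hRs', hPR']
  have hskew : r + tau r = 0 := by
    refine Aux.ext2 _ _ fun f g => ?_
    obtain ⟨x, rfl⟩ := hsurj f
    obtain ⟨y, rfl⟩ := hsurj g
    rw [map_add, Aux.pr_tau, Aux.pr_eq, Aux.pr_eq, hsh, hsh, map_zero, hs y, hRs']
    ring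
  have htau : tau r = - r := (neg_eq_of_add_eq_zero_right hskew).symm
  have hsht : ∀ x, sharp (tau r) (B x) = - R x := by
    intro x
    have := Aux.sharp_add r (tau r) (B x)
    rw [hskew, Aux.sharp_zero, hsh] at this
    exact (neg_eq_of_add_eq_zero_right this.symm).symm
  refine ⟨LinearMap.ext h1, ⟨hc, ha, hP, fun x y => ⟨?_, ?_⟩⟩, hskew, ?_, ?_, ?_⟩
  · refine hB _ _ fun z => ?_
    rw [hc, hf, hPhat, hPhat, hc (P x) y, hf, (hP x z).1]
  · refine hB _ _ fun z => ?_
    rw [hPhat, hPhat, hc (P x) y, hf, hc x, hf, hPhat, (hP x z).1, (hP x z).2]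
  · refine Aux.ext3 _ _ fun f g k => ?_
    obtain ⟨x, rfl⟩ := hsurj f
    obtain ⟨y, rfl⟩ := hsurj g
    obtain ⟨z, rfl⟩ := hsurj k
    rw [Acal, map_add, map_sub, Aux.pr_place1, Aux.pr_place2, Aux.pr_place3, hsh, hsh, hsht, hsht]
    simp only [map_neg, LinearMap.neg_apply, neg_neg, map_zero]
    have e3 : B z (m (R x) (R y)) = - B (R z) (m (R x) y) - B (R z) (m x (R y)) := by
      rw [hRB', map_add, hRs', hRs']; ring
    have e1 : B (R z) (m (R x) y) = B y (m (R z) (R x)) := by rw [← hf, hs]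
    have e2 : B (R z) (m x (R y)) = B x (m (R y) (R z)) := by rw [hs, hf]
    rw [e3, e1, e2]; ring
  · refine Aux.ext2 _ _ fun f g => ?_
    obtain ⟨x, rfl⟩ := hsurj f
    obtain ⟨y, rfl⟩ := hsurj g
    have e : B x ∘ₗ P = B (Phat x) := LinearMap.ext fun z => (hPhat x z).symm
    rw [Aux.pr_rT, Aux.pr_lT, Aux.pr_eq, Aux.pr_eq, e, hsh, hsh, h1]; rfl
  · refine Aux.ext2 _ _ fun f g => ?_
    obtain ⟨x, rfl⟩ := hsurj f
    obtain ⟨y, rfl⟩ := hsurj g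
    have e : B x ∘ₗ Phat = B (P x) := LinearMap.ext fun z => by
      rw [LinearMap.comp_apply, hs, hPhat, hs]
    rw [Aux.pr_rT, Aux.pr_lT, Aux.pr_eq, Aux.pr_eq, e, hsh, hsh, ← hPR']; rfl

end Theorems
end
end
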